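/- arXiv:1701.03545 — 2 statements merged into one kernel-verified Lean document; each statement's English description precedes it below -/
import Mathlib

section
/- Let r > 0 and define a(d,n) = (k(d,n) + (d−1)/2)^{−r}. Then there exist constants c > 0 and C > 0 depending only on r such that for all integers d ≥ 2: (i) for 1 ≤ n ≤ 2^d, c·d^{−r} ≤ a(d,n) ≤ C·d^{−r}; (ii) for n ≥ 2^d, c·d^{−r}·n^{−r/d} ≤ a(d,n) ≤ C·d^{−r}·n^{−r/d}. -/
/-- `C(d,k) = (2k+d)·(k+d−1)!/(k!·d!)`, the dimension of the space of spherical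
polynomials of degree at most `k` on the sphere `S^d`, as a real number. -/
noncomputable def sphC (d k : ℕ) : ℝ :=
  ((2 * k + d : ℕ) : ℝ) * (Nat.factorial (k + d - 1) : ℝ) /
    ((Nat.factorial k : ℝ) * (Nat.factorial d : ℝ))

/-- The approximation numbers `a(d,n) = (k(d,n) + (d−1)/2)^{−r}` of the embedding
`I_d : H^{r,−}(S^d) → L₂(S^d)`, expressed via an index function `kf` with
`kf n = k(d,n)`. -/
noncomputable def aMinus (r : ℝ) (d : ℕ) (kf : ℕ → ℕ) (n : ℕ) : ℝ :=
  ((kf n : ℝ) + ((d : ℝ) - 1) / 2) ^ (-r)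

theorem choose_le_sphC {d : ℕ} (hd : 1 ≤ d) (k : ℕ) : ((k + d).choose d : ℝ) ≤ sphC d k := by
  obtain ⟨e, rfl⟩ := Nat.exists_eq_add_of_le' hd
  rw [← Nat.choose_symm_add, Nat.cast_add_choose ℝ, sphC, show k + (e + 1) - 1 = k + e by omega, ← add_assoc k e 1,
    Nat.factorial_succ (k + e)]
  gcongr
  push_cast
  refine mul_le_mul_of_nonneg_right ?_ (by positivity)
  linarith [(Nat.cast_nonneg k : (0 : ℝ) ≤ k)]

theorem sphC_le_two_mul_choose {d : ℕ} (hd : 1 ≤ d) (k : ℕ) :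
    sphC d k ≤ 2 * ((k + d).choose d : ℝ) := by
  obtain ⟨e, rfl⟩ := Nat.exists_eq_add_of_le' hd
  rw [← Nat.choose_symm_add, Nat.cast_add_choose ℝ, sphC, show k + (e + 1) - 1 = k + e by omega, ← add_assoc k e 1,
    Nat.factorial_succ (k + e), ← mul_div_assoc]
  gcongr ?_ / _
  push_cast
  rw [← mul_assoc]
  refine mul_le_mul_of_nonneg_right ?_ (by positivity)
  linarith [(Nat.cast_nonneg e : (0 : ℝ) ≤ e)]

/-- Each index whose predecessor level has dimension below `y ^ d` is at most `d * y`. -/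
theorem index_le_of_sphC_pred_lt {d k : ℕ} (hd : 1 ≤ d) {y : ℝ} (hy : 0 ≤ y)
    (h : 0 < k → sphC d (k - 1) < y ^ d) : (k : ℝ) ≤ d * y := by
  rcases Nat.eq_zero_or_pos k with rfl | hk
  · simpa using by positivity
  have hchoose : (k : ℝ) ^ d / (d.factorial : ℝ) ≤ ((k - 1 + d).choose d : ℝ) := by
    have := Nat.pow_le_choose (α := ℝ) d (k - 1 + d)
    rwa [show k - 1 + d + 1 - d = k by omega] at this
  have hlt := (hchoose.trans (choose_le_sphC hd (k - 1))).trans (h hk).le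
  rw [div_le_iff₀ (by positivity)] at hlt
  have hfac : (d.factorial : ℝ) ≤ (d : ℝ) ^ d := mod_cast Nat.factorial_le_pow d
  refine le_of_pow_le_pow_left₀ (n := d) (by omega) (by positivity) ?_
  rw [mul_pow, mul_comm]
  exact hlt.trans (by gcongr)

theorem le_of_pow_le_sphC {d k : ℕ} (hd : 1 ≤ d) {y : ℝ} (h : y ^ d ≤ sphC d k) :
    d * y ≤ 6 * (k + d) := by
  have hd0 : (0 : ℝ) < d := by positivity
  have hchoose : ((k + d).choose d : ℝ) ≤ ((k + d : ℕ) : ℝ) ^ d / (d.factorial : ℝ) :=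
    Nat.choose_le_pow_div d (k + d)
  have hexp : (d : ℝ) ^ d / (d.factorial : ℝ) ≤ 3 ^ d := by
    refine (Real.pow_div_factorial_le_exp d hd0.le d).trans ?_
    rw [← Real.exp_one_pow]
    gcongr
    linarith [Real.exp_one_lt_d9]
  refine le_of_pow_le_pow_left₀ (n := d) (by omega) (by positivity) ?_
  calc (d * y) ^ d = (d : ℝ) ^ d * y ^ d := mul_pow _ _ _
    _ ≤ (d : ℝ) ^ d * (2 * (((k + d : ℕ) : ℝ) ^ d / (d.factorial : ℝ))) := by
        gcongr
        exact h.trans ((sphC_le_two_mul_choose hd k).trans (by gcongr))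
    _ = 2 * ((d : ℝ) ^ d / (d.factorial : ℝ)) * ((k + d : ℕ) : ℝ) ^ d := by ring
    _ ≤ 2 ^ d * 3 ^ d * ((k + d : ℕ) : ℝ) ^ d := by
        gcongr
        exact le_self_pow₀ one_le_two (by omega)
    _ = (6 * (k + d)) ^ d := by
        push_cast
        rw [← mul_pow, ← mul_pow]
        norm_num

theorem rpow_neg_bounds {r a b x z : ℝ} (hr : 0 ≤ r) (ha : 0 < a) (hb : 0 ≤ b) (hz : 0 < z)
    (hl : a * z ≤ x) (hu : x ≤ b * z) :
    b ^ (-r) * z ^ (-r) ≤ x ^ (-r) ∧ x ^ (-r) ≤ a ^ (-r) * z ^ (-r) := by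
  have haz : 0 < a * z := mul_pos ha hz
  rw [← Real.mul_rpow hb hz.le, ← Real.mul_rpow ha.le hz.le]
  exact ⟨Real.rpow_le_rpow_of_nonpos (haz.trans_le hl) hu (by linarith),
    Real.rpow_le_rpow_of_nonpos haz hl (by linarith)⟩

/-- Equation (4.11) of Theorem 4.2: preasymptotics and asymptotics of
`a_n(I_d : H^{r,−}(S^d) → L₂(S^d))`, with constants depending only on `r`. -/
theorem sobolev_minus_sphere_asymptotics (r : ℝ) (hr : 0 < r) :
    ∃ c C : ℝ, 0 < c ∧ 0 < C ∧
      ∀ d : ℕ, 2 ≤ d → ∀ kf : ℕ → ℕ,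
        (∀ n : ℕ, 1 ≤ n →
          (n : ℝ) ≤ sphC d (kf n) ∧ (0 < kf n → sphC d (kf n - 1) < (n : ℝ))) →
        (∀ n : ℕ, 1 ≤ n → n ≤ 2 ^ d →
          c * (d : ℝ) ^ (-r) ≤ aMinus r d kf n ∧ aMinus r d kf n ≤ C * (d : ℝ) ^ (-r)) ∧
        (∀ n : ℕ, 2 ^ d ≤ n →
          c * (d : ℝ) ^ (-r) * (n : ℝ) ^ (-(r / (d : ℝ))) ≤ aMinus r d kf n ∧
          aMinus r d kf n ≤ C * (d : ℝ) ^ (-r) * (n : ℝ) ^ (-(r / (d : ℝ)))) := by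
  refine ⟨3 ^ (-r), (1 / 24) ^ (-r), by positivity, by positivity, fun d hd kf hkf => ?_⟩
  have hd2 : (2 : ℝ) ≤ d := mod_cast hd
  have hd0 : (d : ℝ) ≠ 0 := by positivity
  have key : ∀ n : ℕ, 1 ≤ n → (kf n : ℝ) ≤ d * (n : ℝ) ^ (1 / (d : ℝ)) ∧
      d * (n : ℝ) ^ (1 / (d : ℝ)) ≤ 6 * (kf n + d) := by
    intro n hn
    have hpow : ((n : ℝ) ^ (1 / (d : ℝ))) ^ d = n := by
      rw [one_div, Real.rpow_inv_natCast_pow (by positivity) (by omega)]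
    obtain ⟨h1, h2⟩ := hkf n hn
    exact ⟨index_le_of_sphC_pred_lt (by omega) (by positivity) (by rwa [hpow]),
      le_of_pow_le_sphC (by omega) (by rwa [hpow])⟩
  refine ⟨fun n hn hn2 => ?_, fun n hn2 => ?_⟩
  · have hroot : (n : ℝ) ^ (1 / (d : ℝ)) ≤ 2 := by
      rw [one_div, Real.rpow_inv_le_iff_of_pos (by positivity) (by positivity) (by positivity),
        Real.rpow_natCast]
      exact_mod_cast hn2
    have hk : (kf n : ℝ) ≤ d * 2 := (key n hn).1.trans (by gcongr)
    have hk0 : (0 : ℝ) ≤ kf n := Nat.cast_nonneg _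
    exact rpow_neg_bounds hr.le (by norm_num) (by norm_num) (by positivity)
      (by linarith) (by linarith)
  · have hn : 1 ≤ n := Nat.one_le_two_pow.trans hn2
    have hroot : 1 ≤ (n : ℝ) ^ (1 / (d : ℝ)) :=
      Real.one_le_rpow (mod_cast hn) (by positivity)
    have hdroot : (d : ℝ) ≤ d * (n : ℝ) ^ (1 / (d : ℝ)) :=
      le_mul_of_one_le_right (by positivity) hroot
    obtain ⟨hk1, hk2⟩ := key n hn
    have hk0 : (0 : ℝ) ≤ kf n := Nat.cast_nonneg _
    have hz : (d : ℝ) ^ (-r) * (n : ℝ) ^ (-(r / (d : ℝ))) =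
        (d * (n : ℝ) ^ (1 / (d : ℝ))) ^ (-r) := by
      rw [Real.mul_rpow (by positivity) (by positivity), ← Real.rpow_mul (by positivity)]
      congr 2
      ring
    rw [mul_assoc, mul_assoc, hz]
    exact rpow_neg_bounds hr.le (by norm_num) (by norm_num) (by positivity)
      (by linarith) (by linarith)
end

section
/- Let r > 0 and define a(d,n) = (1 + (k̃(d,n)·(k̃(d,n)+d))^r)^{−1/2}. Then there exist constants c > 0 and C > 0 depending only on r such that for all integers d ≥ 2: (i) a(d,1) = 1; (ii) for 2 ≤ n ≤ d, c·d^{−r/2} ≤ a(d,n) ≤ C·d^{−r/2}; (iii) for d ≤ n ≤ 2^d, c·d^{−r/2}·(ln(1+d/ln n)/ln n)^{r/2} ≤ a(d,n) ≤ C·d^{−r/2}·(ln(1+d/ln n)/ln n)^{r/2}; (iv) for n ≥ 2^d, c·d^{−r}·n^{−r/d} ≤ a(d,n) ≤ C·d^{−r}·n^{−r/d}. -/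
/-- `D(d,k) = binom(k+d,d)`, the dimension of the space of polynomials of degree at
most `k` on the unit ball `B^d ⊂ ℝ^d`. -/
def ballD (d k : ℕ) : ℕ := (k + d).choose d

/-- The approximation numbers `a(d,n) = (1 + (k̃(d,n)·(k̃(d,n)+d))^r)^{−1/2}` of the
embedding `I_d : H^{r,*}(B^d) → L₂(B^d)`, expressed via an index function `kf` with
`kf n = k̃(d,n)`. -/
noncomputable def aStarBall (r : ℝ) (d : ℕ) (kf : ℕ → ℕ) (n : ℕ) : ℝ :=
  (1 + ((kf n : ℝ) * ((kf n : ℝ) + (d : ℝ))) ^ r) ^ (-(1 / 2) : ℝ)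

theorem one_add_div_pow_le_choose (a b : ℕ) :
    (1 + (a : ℝ) / b) ^ b ≤ ((a + b).choose b : ℝ) := by
  induction b with
  | zero => simp
  | succ b ih =>
    have hrec : ((a + (b + 1)).choose (b + 1) : ℝ) =
        (1 + (a : ℝ) / ((b + 1 : ℕ) : ℝ)) * ((a + b).choose b : ℝ) := by
      have h : ((a + b + 1 : ℕ) : ℝ) * ((a + b).choose b : ℝ) =
          ((a + b + 1).choose (b + 1) : ℝ) * ((b + 1 : ℕ) : ℝ) := by
        exact_mod_cast Nat.add_one_mul_choose_eq (a + b) b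
      rw [← add_assoc]
      have hb : ((b + 1 : ℕ) : ℝ) ≠ 0 := by positivity
      field_simp
      rw [← h]
      push_cast
      ring
    rw [hrec, pow_succ']
    gcongr
    refine le_trans ?_ ih
    rcases Nat.eq_zero_or_pos b with rfl | hb
    · simp
    · gcongr
      simp

theorem choose_le_exp_mul_one_add_div_pow (a : ℕ) {b : ℕ} (hb : 0 < b) :
    ((a + b).choose b : ℝ) ≤ (Real.exp 1 * (1 + (a : ℝ) / b)) ^ b := by
  have hb' : (0 : ℝ) < b := by exact_mod_cast hb
  have h1 : ((a + b).choose b : ℝ) ≤ ((a + b : ℕ) : ℝ) ^ b / (b.factorial : ℝ) :=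
    Nat.choose_le_pow_div b (a + b)
  have h2 : (b : ℝ) ^ b / (b.factorial : ℝ) ≤ Real.exp b :=
    Real.pow_div_factorial_le_exp b hb'.le b
  have h3 : ((a + b : ℕ) : ℝ) ^ b / (b.factorial : ℝ) =
      (b : ℝ) ^ b / (b.factorial : ℝ) * (1 + (a : ℝ) / b) ^ b := by
    rw [div_mul_eq_mul_div, ← mul_pow]
    congr 2
    push_cast
    field_simp
    ring
  rw [mul_pow, ← Real.exp_nat_mul, mul_one]
  rw [h3] at h1
  exact h1.trans (by gcongr)

theorem mul_log_one_add_div_le_log_choose (a : ℕ) {b : ℕ} (hb : 0 < b) :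
    (b : ℝ) * Real.log (1 + (a : ℝ) / b) ≤ Real.log ((a + b).choose b) := by
  rw [← Real.log_pow]
  exact Real.log_le_log (by positivity) (one_add_div_pow_le_choose a b)

theorem log_choose_le (a : ℕ) {b : ℕ} (hb : 0 < b) :
    Real.log ((a + b).choose b) ≤ (b : ℝ) * (1 + Real.log (1 + (a : ℝ) / b)) := by
  have h := Real.log_le_log (by exact_mod_cast Nat.choose_pos (by omega))
    (choose_le_exp_mul_one_add_div_pow a hb)
  rwa [Real.log_pow, Real.log_mul (by positivity) (by positivity), Real.log_exp] at h

theorem ballD_mono (d : ℕ) : Monotone (ballD d) :=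
  fun _ _ h => Nat.choose_le_choose d (by omega)

theorem ballD_eq_choose (d k : ℕ) : ballD d k = (d + k).choose k := by
  rw [ballD, add_comm k d, Nat.choose_symm_add]

theorem two_pow_le_ballD_self (d : ℕ) : 2 ^ d ≤ ballD d d := by
  have h := one_add_div_pow_le_choose d d
  rcases Nat.eq_zero_or_pos d with rfl | hd
  · simp [ballD]
  · have hd' : (d : ℝ) ≠ 0 := by positivity
    rw [div_self hd', one_add_one_eq_two] at h
    exact_mod_cast h

/-- The index condition at `n` that determines `k̃(d,n)`. -/
def IsBallIndex (d n k : ℕ) : Prop :=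
  n ≤ ballD d k ∧ (0 < k → ballD d (k - 1) < n)

namespace IsBallIndex

variable {d n k : ℕ}

theorem eq_zero (h : IsBallIndex d 1 k) : k = 0 := by
  by_contra hk
  have h1 := h.2 (Nat.pos_of_ne_zero hk)
  have h2 : 0 < ballD d (k - 1) := Nat.choose_pos (by omega)
  omega

theorem pos (h : IsBallIndex d n k) (hn : 2 ≤ n) : 0 < k := by
  by_contra hk
  have h0 : k = 0 := by omega
  subst h0
  have := h.1
  simp [ballD] at this
  omega

theorem le_of_le_ballD (h : IsBallIndex d n k) {m : ℕ} (hm : n ≤ ballD d m) : k ≤ m := by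
  by_contra! hk
  have h1 := h.2 (by omega)
  have h2 := ballD_mono d (show m ≤ k - 1 by omega)
  omega

theorem eq_one (h : IsBallIndex d n k) (hn : 2 ≤ n) (hnd : n ≤ d) : k = 1 := by
  have h1 : k ≤ 1 := h.le_of_le_ballD (by simp [ballD, add_comm 1 d]; omega)
  have := h.pos hn
  omega

theorem le_dim (h : IsBallIndex d n k) (hn : n ≤ 2 ^ d) : k ≤ d :=
  h.le_of_le_ballD (hn.trans (two_pow_le_ballD_self d))

theorem log_le (h : IsBallIndex d n k) (hn : 2 ≤ n) :
    Real.log n ≤ k * (1 + Real.log (1 + (d : ℝ) / k)) := by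
  refine le_trans ?_ (log_choose_le d (h.pos hn))
  rw [← ballD_eq_choose]
  exact Real.log_le_log (by positivity) (by exact_mod_cast h.1)

theorem mul_log_le (h : IsBallIndex d n k) (hk : 2 ≤ k) :
    ((k - 1 : ℕ) : ℝ) * Real.log (1 + (d : ℝ) / (k - 1 : ℕ)) ≤ Real.log n := by
  refine (mul_log_one_add_div_le_log_choose d (by omega)).trans ?_
  have h1 := h.2 (by omega)
  rw [ballD_eq_choose] at h1
  refine Real.log_le_log ?_ (by exact_mod_cast h1.le)
  exact_mod_cast Nat.choose_pos (by omega)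

end IsBallIndex

theorem log_one_add_le_two_mul_sqrt {t : ℝ} (ht : 0 ≤ t) :
    Real.log (1 + t) ≤ 2 * √t := by
  have h1 : 1 + t ≤ (1 + √t) ^ 2 := by
    nlinarith [Real.sq_sqrt ht, Real.sqrt_nonneg t]
  have h2 := Real.log_le_log (by positivity) h1
  rw [Real.log_pow] at h2
  have h3 := Real.log_le_sub_one_of_pos (show 0 < 1 + √t by positivity)
  push_cast at h2
  linarith

theorem log_one_add_le_log_one_add_div_log {t : ℝ} (ht : 0 < t) :
    Real.log (1 + t) ≤ 12 * Real.log (1 + t / (3 * Real.log (1 + t))) := by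
  have hs : 0 < √t := Real.sqrt_pos.mpr ht
  have hlog : 0 < Real.log (1 + t) := Real.log_pos (by linarith)
  have h1 : √t / 6 ≤ t / (3 * Real.log (1 + t)) := by
    rw [div_le_div_iff₀ (by norm_num) (by positivity)]
    nlinarith [log_one_add_le_two_mul_sqrt ht.le, Real.mul_self_sqrt ht.le]
  have h2 : 1 + t ≤ (1 + √t / 6) ^ 12 := by
    have hb : 1 + √t ≤ (1 + √t / 6) ^ 6 := by
      have := one_add_mul_le_pow (show (-2 : ℝ) ≤ √t / 6 by linarith) 6
      push_cast at this
      linarith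
    calc 1 + t ≤ (1 + √t) ^ 2 := by nlinarith [Real.sq_sqrt ht.le]
      _ ≤ ((1 + √t / 6) ^ 6) ^ 2 := by gcongr
      _ = _ := by ring
  calc Real.log (1 + t) ≤ Real.log ((1 + √t / 6) ^ 12) := Real.log_le_log (by positivity) h2
    _ = 12 * Real.log (1 + √t / 6) := by rw [Real.log_pow]; norm_num
    _ ≤ _ := by gcongr

theorem half_lt_log_two : (1 / 2 : ℝ) < Real.log 2 := by
  linarith [Real.log_two_gt_d9]

theorem log_one_add_two_mul_le {t : ℝ} (ht : 0 ≤ t) :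
    Real.log (1 + 2 * t) ≤ 2 * Real.log (1 + t) := by
  have h := Real.log_le_log (show 0 < 1 + 2 * t by positivity)
    (show 1 + 2 * t ≤ (1 + t) ^ 2 by nlinarith)
  rw [Real.log_pow] at h
  exact_mod_cast h

namespace IsBallIndex

variable {d n k : ℕ}

theorem log_le_mul_log (h : IsBallIndex d n k) (hn : 2 ≤ n) (hnd : n ≤ 2 ^ d) :
    Real.log n ≤ 36 * (k * Real.log (1 + d / Real.log n)) := by
  have hk : (0 : ℝ) < k := by exact_mod_cast h.pos hn
  have hkd : (k : ℝ) ≤ d := by exact_mod_cast h.le_dim hnd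
  have hL : 0 < Real.log n := Real.log_pos (by exact_mod_cast hn)
  have ht : (1 : ℝ) ≤ d / k := (one_le_div hk).mpr hkd
  have hlog2 : (1 / 2 : ℝ) < Real.log (1 + (d : ℝ) / k) :=
    half_lt_log_two.trans_le (Real.log_le_log (by norm_num) (by linarith))
  have h1 : Real.log n ≤ 3 * (k * Real.log (1 + (d : ℝ) / k)) := by
    have := h.log_le hn
    nlinarith
  have h2 : (d : ℝ) / k / (3 * Real.log (1 + (d : ℝ) / k)) ≤ d / Real.log n := by
    rw [div_div]
    gcongr
    linarith
  have h3 := log_one_add_le_log_one_add_div_log (show 0 < (d : ℝ) / k by linarith)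
  have h4 : Real.log (1 + (d : ℝ) / k / (3 * Real.log (1 + (d : ℝ) / k))) ≤
      Real.log (1 + d / Real.log n) := by
    gcongr
  have h5 : (k : ℝ) * Real.log (1 + (d : ℝ) / k) ≤ k * (12 * Real.log (1 + d / Real.log n)) := by
    gcongr
    linarith
  linarith

theorem mul_log_le_log (h : IsBallIndex d n k) (hd : 2 ≤ d) (hdn : d ≤ n) (hnd : n ≤ 2 ^ d) :
    k * Real.log (1 + d / Real.log n) ≤ 4 * Real.log n := by
  have hd' : (2 : ℝ) ≤ d := by exact_mod_cast hd
  have hkd := h.le_dim hnd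
  have hk := h.pos (hd.trans hdn)
  have hL : Real.log d ≤ Real.log n :=
    Real.log_le_log (by positivity) (by exact_mod_cast hdn)
  have hd2 : Real.log 2 ≤ Real.log d := Real.log_le_log (by norm_num) hd'
  have hhalf := half_lt_log_two
  rcases Nat.lt_or_ge k 2 with hk2 | hk2
  · have hk1 : k = 1 := by omega
    subst hk1
    have h1 : (d : ℝ) / Real.log n ≤ 2 * d := by
      rw [div_le_iff₀ (by linarith)]
      nlinarith
    have h2 : Real.log (1 + d / Real.log n) ≤ Real.log ((d : ℝ) ^ 3) := by
      refine Real.log_le_log ?_ ?_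
      · have : 0 ≤ (d : ℝ) / Real.log n := div_nonneg (by linarith) (by linarith)
        linarith
      · nlinarith [mul_nonneg (sub_nonneg.2 hd') (sub_nonneg.2 hd'), sq_nonneg (d : ℝ)]
    rw [Real.log_pow] at h2
    push_cast at h2 ⊢
    linarith
  · have hj : (0 : ℝ) < (k - 1 : ℕ) := by exact_mod_cast (by omega : 0 < k - 1)
    have hjd : ((k - 1 : ℕ) : ℝ) ≤ d := by exact_mod_cast (by omega : k - 1 ≤ d)
    have hkj : (k : ℝ) ≤ 2 * (k - 1 : ℕ) := by exact_mod_cast (by omega : k ≤ 2 * (k - 1))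
    have h1 := h.mul_log_le hk2
    generalize ((k - 1 : ℕ) : ℝ) = j at *
    have ht : (1 : ℝ) ≤ d / j := (one_le_div hj).mpr hjd
    have hlog2 : (1 / 2 : ℝ) < Real.log (1 + (d : ℝ) / j) :=
      hhalf.trans_le (Real.log_le_log (by norm_num) (by linarith))
    have hLj : j ≤ 2 * Real.log n := by nlinarith
    have h2 : (d : ℝ) / Real.log n ≤ 2 * (d / j) := by
      rw [← mul_div_assoc, div_le_div_iff₀ (by linarith) hj]
      nlinarith
    have hpos : 0 ≤ (d : ℝ) / Real.log n := div_nonneg (by linarith) (by linarith)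
    have h3 : Real.log (1 + d / Real.log n) ≤ 2 * Real.log (1 + (d : ℝ) / j) :=
      (Real.log_le_log (by linarith) (by linarith)).trans (log_one_add_two_mul_le (by linarith))
    calc k * Real.log (1 + d / Real.log n)
        ≤ (2 * j) * (2 * Real.log (1 + (d : ℝ) / j)) := by
          gcongr
          exact Real.log_nonneg (by linarith)
      _ ≤ 4 * Real.log n := by linarith

theorem dim_le (h : IsBallIndex d n k) (hd : 2 ≤ d) (hn : 2 ^ d ≤ n) : (d : ℝ) ≤ 25 * k := by
  have hn2 : 2 ≤ n := (Nat.le_self_pow (by omega) 2).trans hn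
  have hk : (0 : ℝ) < k := by exact_mod_cast h.pos hn2
  have hd' : (2 : ℝ) ≤ d := by exact_mod_cast hd
  have h1 := h.log_le hn2
  have h2 : d * Real.log 2 ≤ Real.log n := by
    rw [← Real.log_pow]
    exact Real.log_le_log (by positivity) (by exact_mod_cast hn)
  have h3 := log_one_add_le_two_mul_sqrt (show 0 ≤ (d : ℝ) / k by positivity)
  have hhalf := half_lt_log_two
  have hdk : (d : ℝ) = k * (d / k) := by field_simp
  have ht : 0 ≤ (d : ℝ) / k := by positivity
  generalize (d : ℝ) / k = t at *
  have h4 : t / 2 ≤ 1 + 2 * √t := by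
    have h5 : k * (t / 2) ≤ k * (1 + 2 * √t) := by
      calc k * (t / 2) = d * (1 / 2) := by rw [hdk]; ring
        _ ≤ d * Real.log 2 := by gcongr
        _ ≤ k * (1 + Real.log (1 + t)) := h2.trans h1
        _ ≤ _ := by gcongr
    exact le_of_mul_le_mul_left h5 hk
  have h6 : t ≤ 25 := by
    have hs := Real.sqrt_nonneg t
    have hsq := Real.sq_sqrt ht
    nlinarith
  rw [hdk, mul_comm]
  gcongr

theorem root_bounds (h : IsBallIndex d n k) (hd : 2 ≤ d) (hn : 2 ≤ n) {u : ℝ} (hu : 0 ≤ u)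
    (hun : u ^ d = n) : d * u ≤ 3 * (k + d) ∧ (k : ℝ) + d ≤ 2 * (d * u) := by
  have hd' : (2 : ℝ) ≤ d := by exact_mod_cast hd
  have hk := h.pos hn
  constructor
  · have h1 : u ^ d ≤ (Real.exp 1 * (1 + (k : ℝ) / d)) ^ d := by
      rw [hun]
      refine le_trans ?_ (choose_le_exp_mul_one_add_div_pow k (by omega))
      exact_mod_cast h.1
    have h2 := le_of_pow_le_pow_left₀ (by omega) (by positivity) h1
    have h3 := Real.exp_one_lt_d9
    calc d * u ≤ d * (3 * (1 + (k : ℝ) / d)) := by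
          gcongr
          refine h2.trans ?_
          gcongr
          linarith
      _ = 3 * (k + d) := by field_simp; ring
  · have h1 : (1 + ((k - 1 : ℕ) : ℝ) / d) ^ d ≤ u ^ d := by
      rw [hun]
      refine (one_add_div_pow_le_choose (k - 1) d).trans ?_
      exact_mod_cast (h.2 hk).le
    have h2 := le_of_pow_le_pow_left₀ (by omega) hu h1
    have h3 : (d : ℝ) + (k - 1 : ℕ) ≤ d * u := by
      calc (d : ℝ) + (k - 1 : ℕ) = d * (1 + ((k - 1 : ℕ) : ℝ) / d) := by field_simp
        _ ≤ _ := by gcongr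
    rw [Nat.cast_sub hk] at h3
    have hk' : (1 : ℝ) ≤ k := by exact_mod_cast hk
    push_cast at h3
    linarith

end IsBallIndex

theorem aStarBall_bounds {r : ℝ} (hr : 0 < r) {d : ℕ} {kf : ℕ → ℕ} {n : ℕ} {m M Z : ℝ}
    (hk : 0 < kf n) (hm : 0 < m) (hM : 0 < M) (hZ : 0 < Z)
    (h1 : m * Z ≤ kf n * (kf n + d)) (h2 : kf n * ((kf n : ℝ) + d) ≤ M * Z) :
    (2 : ℝ) ^ (-(1 / 2) : ℝ) * M ^ (-(r / 2)) * Z ^ (-(r / 2)) ≤ aStarBall r d kf n ∧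
      aStarBall r d kf n ≤ m ^ (-(r / 2)) * Z ^ (-(r / 2)) := by
  have hk' : (1 : ℝ) ≤ kf n := by exact_mod_cast hk
  have hX1 : 1 ≤ (kf n : ℝ) * ((kf n : ℝ) + d) := by
    have : (0 : ℝ) ≤ d := by positivity
    nlinarith
  unfold aStarBall
  generalize (kf n : ℝ) * ((kf n : ℝ) + d) = X at *
  have hXr : 1 ≤ X ^ r := Real.one_le_rpow hX1 hr.le
  have hX0 : 0 < X := by linarith
  have hpow : (X ^ r) ^ (-(1 / 2) : ℝ) = X ^ (-(r / 2)) := by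
    rw [← Real.rpow_mul hX0.le]
    congr 1
    ring
  constructor
  · calc (2 : ℝ) ^ (-(1 / 2) : ℝ) * M ^ (-(r / 2)) * Z ^ (-(r / 2))
        = (2 : ℝ) ^ (-(1 / 2) : ℝ) * (M * Z) ^ (-(r / 2)) := by
          rw [Real.mul_rpow hM.le hZ.le, mul_assoc]
      _ ≤ (2 : ℝ) ^ (-(1 / 2) : ℝ) * X ^ (-(r / 2)) := by
          gcongr 2 ^ (-(1 / 2) : ℝ) * ?_
          exact Real.rpow_le_rpow_of_nonpos hX0 h2 (by linarith)
      _ = (2 * X ^ r) ^ (-(1 / 2) : ℝ) := by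
          rw [Real.mul_rpow (by norm_num) (by linarith), hpow]
      _ ≤ _ := Real.rpow_le_rpow_of_nonpos (by linarith) (by linarith) (by norm_num)
  · calc (1 + X ^ r) ^ (-(1 / 2) : ℝ) ≤ (X ^ r) ^ (-(1 / 2) : ℝ) :=
          Real.rpow_le_rpow_of_nonpos (by linarith) (by linarith) (by norm_num)
      _ = X ^ (-(r / 2)) := hpow
      _ ≤ (m * Z) ^ (-(r / 2)) :=
          Real.rpow_le_rpow_of_nonpos (by positivity) h1 (by linarith)
      _ = _ := Real.mul_rpow hm.le hZ.le

/-- Theorem 6.4: preasymptotics and asymptotics of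
`a_n(I_d : H^{r,*}(B^d) → L₂(B^d))`, with constants depending only on `r`. -/
theorem sobolev_star_ball_asymptotics (r : ℝ) (hr : 0 < r) :
    ∃ c C : ℝ, 0 < c ∧ 0 < C ∧
      ∀ d : ℕ, 2 ≤ d → ∀ kf : ℕ → ℕ,
        (∀ n : ℕ, 1 ≤ n →
          n ≤ ballD d (kf n) ∧ (0 < kf n → ballD d (kf n - 1) < n)) →
        (aStarBall r d kf 1 = 1) ∧
        (∀ n : ℕ, 2 ≤ n → n ≤ d →
          c * (d : ℝ) ^ (-(r / 2)) ≤ aStarBall r d kf n ∧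
          aStarBall r d kf n ≤ C * (d : ℝ) ^ (-(r / 2))) ∧
        (∀ n : ℕ, d ≤ n → n ≤ 2 ^ d →
          c * (d : ℝ) ^ (-(r / 2)) *
              (Real.log (1 + (d : ℝ) / Real.log n) / Real.log n) ^ (r / 2) ≤
            aStarBall r d kf n ∧
          aStarBall r d kf n ≤
            C * (d : ℝ) ^ (-(r / 2)) *
              (Real.log (1 + (d : ℝ) / Real.log n) / Real.log n) ^ (r / 2)) ∧
        (∀ n : ℕ, 2 ^ d ≤ n →
          c * (d : ℝ) ^ (-r) * (n : ℝ) ^ (-(r / (d : ℝ))) ≤ aStarBall r d kf n ∧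
          aStarBall r d kf n ≤ C * (d : ℝ) ^ (-r) * (n : ℝ) ^ (-(r / (d : ℝ)))) := by
  refine ⟨(2 : ℝ) ^ (-(1 / 2) : ℝ) * 8 ^ (-(r / 2)), (1 / 234 : ℝ) ^ (-(r / 2)),
    by positivity, by positivity, ?_⟩
  intro d hd kf hkf
  have hidx : ∀ n, 1 ≤ n → IsBallIndex d n (kf n) := hkf
  have hd' : (2 : ℝ) ≤ d := by exact_mod_cast hd
  refine ⟨?_, ?_, ?_, ?_⟩
  · simp [aStarBall, (hidx 1 le_rfl).eq_zero, Real.zero_rpow hr.ne']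
  · intro n hn hnd
    have h1 := (hidx n (by omega)).eq_one hn hnd
    refine aStarBall_bounds hr (by omega) (by norm_num) (by norm_num) (by linarith) ?_ ?_ <;>
    · rw [h1]
      push_cast
      linarith
  · intro n hdn hnd
    have h := hidx n (by omega)
    have hn : 2 ≤ n := hd.trans hdn
    have hk : (0 : ℝ) < kf n := by exact_mod_cast h.pos hn
    have hkd : (kf n : ℝ) ≤ d := by exact_mod_cast h.le_dim hnd
    have h1 := h.log_le_mul_log hn hnd
    have h2 := h.mul_log_le_log hd hdn hnd
    have hL : 0 < Real.log n := Real.log_pos (by exact_mod_cast hn)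
    have hW : 0 < Real.log (1 + (d : ℝ) / Real.log n) :=
      Real.log_pos (by linarith [show 0 < (d : ℝ) / Real.log n by positivity])
    generalize Real.log (1 + (d : ℝ) / Real.log n) = W at *
    generalize Real.log n = L at *
    have hZ : ((d : ℝ) * (L / W)) ^ (-(r / 2)) = (d : ℝ) ^ (-(r / 2)) * (W / L) ^ (r / 2) := by
      rw [Real.mul_rpow (by positivity) (by positivity), Real.rpow_neg (by positivity : 0 ≤ L / W),
        ← Real.inv_rpow (by positivity), inv_div]
    rw [mul_assoc, mul_assoc ((1 / 234 : ℝ) ^ (-(r / 2))), ← hZ]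
    have h3 : L / W ≤ 36 * kf n := by
      rw [div_le_iff₀ hW]
      linarith
    have h4 : kf n ≤ 4 * (L / W) := by
      rw [← mul_div_assoc, le_div_iff₀ hW]
      exact h2
    refine aStarBall_bounds hr (h.pos hn) (by norm_num) (by norm_num) (by positivity) ?_ ?_
    · nlinarith [mul_le_mul_of_nonneg_left h3 (by linarith : (0 : ℝ) ≤ d),
        mul_pos hk (by linarith : (0 : ℝ) < d)]
    · nlinarith [mul_le_mul_of_nonneg_left h4 (by linarith : (0 : ℝ) ≤ d)]
  · intro n hn
    have hn2 : 2 ≤ n := (Nat.le_self_pow (by omega) 2).trans hn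
    have h := hidx n (by omega)
    have hk : (0 : ℝ) < kf n := by exact_mod_cast h.pos hn2
    have hn0 : (0 : ℝ) < n := by positivity
    have hu : 0 < (n : ℝ) ^ (1 / (d : ℝ)) := by positivity
    have hun : ((n : ℝ) ^ (1 / (d : ℝ))) ^ d = n := by
      rw [one_div]
      exact Real.rpow_inv_natCast_pow hn0.le (by omega)
    have hur : (n : ℝ) ^ (-(r / (d : ℝ))) = ((n : ℝ) ^ (1 / (d : ℝ))) ^ (-r) := by
      rw [← Real.rpow_mul hn0.le]
      congr 1
      ring
    rw [hur]
    obtain ⟨h1, h2⟩ := h.root_bounds hd hn2 hu.le hun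
    have h3 := h.dim_le hd hn
    generalize (n : ℝ) ^ (1 / (d : ℝ)) = u at *
    have hdu : 0 < d * u := by positivity
    have hZ : ((d * u) ^ 2) ^ (-(r / 2)) = (d : ℝ) ^ (-r) * u ^ (-r) := by
      rw [← Real.rpow_natCast, ← Real.rpow_mul hdu.le,
        ← Real.mul_rpow (by positivity) hu.le]
      congr 1
      push_cast
      ring
    rw [mul_assoc, mul_assoc ((1 / 234 : ℝ) ^ (-(r / 2))), ← hZ]
    refine aStarBall_bounds hr (h.pos hn2) (by norm_num) (by norm_num) (by positivity) ?_ ?_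
    · have h4 : (d * u) ^ 2 ≤ (3 * (kf n + d)) ^ 2 := by gcongr
      have h5 : ((kf n : ℝ) + d) * (kf n + d) ≤ (26 * kf n) * (kf n + d) := by
        gcongr
        linarith
      linarith
    · have h4 : ((kf n : ℝ) + d) ^ 2 ≤ (2 * (d * u)) ^ 2 := by gcongr
      nlinarith [mul_pos hk hk]
end
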